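/- Let ω ∈ (0,1) and ε > 0. Set Q(x,y) = (1−ωx)² + ω²y² and, for (x,y) in the open unit disk, λ > 0 and angles θ, ψ, φ, define d(x,y,θ,ψ,φ) = (cos ψ cos φ − cos θ sin φ sin ψ + sin θ cos φ)·((1−ωx)² − ω²y²)/Q(x,y)² + 2(cos ψ sin φ + cos θ cos φ sin ψ + sin θ sin φ)·((1−ωx)ωy)/Q(x,y)², and F(x,y,λ,θ,ψ,φ) = λ⁻² [ 2/(1−x²−y²)² − ελ·d(x,y,θ,ψ,φ) ]. Then the point P₀ = (ω, 0, 2/ε, π/2, 0, 0) is a critical point of F (the gradient of F in the six variables vanishes at P₀), and the Hessian of F at P₀ equals (2ε²/(1−ω²)²)·A_{ω,ε}, where, in the variable ordering (x,y,λ,θ,ψ,φ), A_{ω,ε} is the symmetric 6×6 matrix with entries A₁₁ = A₂₂ = 1/(1−ω²) + 3ω²/(1−ω²)², A₁₃ = A₃₁ = −εω/(2(1−ω²)), A₂₆ = A₆₂ = −ω/(1−ω²), A₃₃ = ε²/8, A₄₄ = A₅₅ = 1/4, A₆₆ = 1/2, and all other entries zero; moreover A_{ω,ε} is positive definite. -/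

import Mathlib

noncomputable section

/-- If `f` is differentiable at `p`, its derivative along a coordinate vector is the derivative of
`f` in that coordinate. -/
lemma fderiv_single_eq_of_hasDerivAt_update {ι : Type*} [Fintype ι] [DecidableEq ι]
    {f : (ι → ℝ) → ℝ} {p : ι → ℝ} {j : ι} {c : ℝ} (hf : DifferentiableAt ℝ f p)
    (h : HasDerivAt (fun t => f (Function.update p j t)) c (p j)) :
    fderiv ℝ f p (Pi.single j (1 : ℝ)) = c := by
  have hu := hasDerivAt_update p j (p j)
  have hf' : HasFDerivAt f (fderiv ℝ f p) (Function.update p j (p j)) := by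
    rw [Function.update_eq_self]
    exact hf.hasFDerivAt
  exact (hf'.comp_hasDerivAt (p j) hu).unique h

/-- The reduced functional in the variables `(x, y, λ, θ, ψ, φ)`. -/
def reducedFunctional (ω ε : ℝ) (p : Fin 6 → ℝ) : ℝ :=
  (1 / (p 2) ^ 2) * (2 / (1 - (p 0) ^ 2 - (p 1) ^ 2) ^ 2 - ε * p 2 *
    ((Real.cos (p 4) * Real.cos (p 5) - Real.cos (p 3) * Real.sin (p 5) * Real.sin (p 4) +
          Real.sin (p 3) * Real.cos (p 5)) *
        (((1 - ω * p 0) ^ 2 - ω ^ 2 * (p 1) ^ 2) /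
          ((1 - ω * p 0) ^ 2 + ω ^ 2 * (p 1) ^ 2) ^ 2) +
      2 * (Real.cos (p 4) * Real.sin (p 5) + Real.cos (p 3) * Real.cos (p 5) * Real.sin (p 4) +
          Real.sin (p 3) * Real.sin (p 5)) *
        (((1 - ω * p 0) * ω * p 1) / ((1 - ω * p 0) ^ 2 + ω ^ 2 * (p 1) ^ 2) ^ 2)))

/-- The open set on which no denominator of the reduced functional vanishes. -/
def regularSet (ω : ℝ) : Set (Fin 6 → ℝ) :=
  {p | p 2 ≠ 0 ∧ 1 - (p 0) ^ 2 - (p 1) ^ 2 ≠ 0 ∧ (1 - ω * p 0) ^ 2 + ω ^ 2 * (p 1) ^ 2 ≠ 0}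

lemma isOpen_regularSet (ω : ℝ) : IsOpen (regularSet ω) :=
  (isOpen_ne_fun (by fun_prop) (by fun_prop)).inter
    ((isOpen_ne_fun (by fun_prop) (by fun_prop)).inter (isOpen_ne_fun (by fun_prop) (by fun_prop)))

lemma contDiffAt_reducedFunctional {ω ε : ℝ} {p : Fin 6 → ℝ} (hp : p ∈ regularSet ω) :
    ContDiffAt ℝ 2 (reducedFunctional ω ε) p := by
  obtain ⟨h2, hD, hQ⟩ := hp
  unfold reducedFunctional
  fun_prop (disch :=
    first | exact pow_ne_zero _ h2 | exact pow_ne_zero _ hD | exact pow_ne_zero _ hQ)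

/-- The partial derivatives of the reduced functional. -/
def reducedGradient (ω ε : ℝ) (p : Fin 6 → ℝ) : Fin 6 → ℝ :=
  let s := 1 - ω * p 0
  let D := 1 - (p 0) ^ 2 - (p 1) ^ 2
  let Q := (1 - ω * p 0) ^ 2 + ω ^ 2 * (p 1) ^ 2
  let N := (1 - ω * p 0) ^ 2 - ω ^ 2 * (p 1) ^ 2
  let u := Real.cos (p 4) * Real.cos (p 5) - Real.cos (p 3) * Real.sin (p 5) * Real.sin (p 4) +
    Real.sin (p 3) * Real.cos (p 5)
  let v := Real.cos (p 4) * Real.sin (p 5) + Real.cos (p 3) * Real.cos (p 5) * Real.sin (p 4) +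
    Real.sin (p 3) * Real.sin (p 5)
  ![8 * p 0 / (p 2 ^ 2 * D ^ 3) - ε / p 2 * (u * (4 * ω * s * N / Q ^ 3 - 2 * ω * s / Q ^ 2) +
      2 * v * (4 * ω ^ 2 * s ^ 2 * p 1 / Q ^ 3 - ω ^ 2 * p 1 / Q ^ 2)),
    8 * p 1 / (p 2 ^ 2 * D ^ 3) - ε / p 2 *
      (u * (- (4 * ω ^ 2 * p 1 * N / Q ^ 3) - 2 * ω ^ 2 * p 1 / Q ^ 2) +
      2 * v * (s * ω / Q ^ 2 - 4 * ω ^ 3 * s * p 1 ^ 2 / Q ^ 3)),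
    -(4 / (p 2 ^ 3 * D ^ 2)) + ε / p 2 ^ 2 * (u * (N / Q ^ 2) + 2 * v * (s * ω * p 1 / Q ^ 2)),
    -(ε / p 2) * ((Real.sin (p 3) * Real.sin (p 5) * Real.sin (p 4) +
        Real.cos (p 3) * Real.cos (p 5)) * (N / Q ^ 2) +
      2 * (Real.cos (p 3) * Real.sin (p 5) - Real.sin (p 3) * Real.cos (p 5) * Real.sin (p 4)) *
        (s * ω * p 1 / Q ^ 2)),
    -(ε / p 2) * ((-(Real.sin (p 4) * Real.cos (p 5)) -
        Real.cos (p 3) * Real.sin (p 5) * Real.cos (p 4)) * (N / Q ^ 2) +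
      2 * (Real.cos (p 3) * Real.cos (p 5) * Real.cos (p 4) - Real.sin (p 4) * Real.sin (p 5)) *
        (s * ω * p 1 / Q ^ 2)),
    -(ε / p 2) * (-v * (N / Q ^ 2) + 2 * u * (s * ω * p 1 / Q ^ 2))]

lemma fderiv_reducedFunctional_single {ω ε : ℝ} {p : Fin 6 → ℝ} (hp : p ∈ regularSet ω)
    (j : Fin 6) :
    fderiv ℝ (reducedFunctional ω ε) p (Pi.single j (1 : ℝ)) = reducedGradient ω ε p j := by
  apply fderiv_single_eq_of_hasDerivAt_update
    ((contDiffAt_reducedFunctional hp).differentiableAt (by norm_num))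
  obtain ⟨h2, hD, hQ⟩ := hp
  fin_cases j <;> simp [reducedFunctional, reducedGradient, Function.update] <;>
  · apply HasDerivAt.congr_deriv
    case h =>
      repeat' first
        | exact hasDerivAt_const _ _
        | exact hasDerivAt_id' _
        | with_reducible apply HasDerivAt.fun_add
        | with_reducible apply HasDerivAt.fun_sub
        | with_reducible apply HasDerivAt.fun_mul
        | with_reducible apply HasDerivAt.fun_div
        | with_reducible apply HasDerivAt.fun_inv
        | with_reducible apply HasDerivAt.fun_pow
        | apply HasDerivAt.cos
        | apply HasDerivAt.sin
        | apply pow_ne_zero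
        | exact h2
        | exact hD
        | exact hQ
    case h' =>
      simp
      field_simp
      ring

/-- The critical point of the reduced functional. -/
def criticalPoint (ω ε : ℝ) : Fin 6 → ℝ := ![ω, 0, 2 / ε, Real.pi / 2, 0, 0]

/-- The Hessian at the critical point, up to the factor `2ε²/(1−ω²)²`. -/
def hessianMatrix (ω ε : ℝ) : Matrix (Fin 6) (Fin 6) ℝ :=
  !![1 / (1 - ω ^ 2) + 3 * ω ^ 2 / (1 - ω ^ 2) ^ 2, 0, -(ε * ω / (2 * (1 - ω ^ 2))), 0, 0, 0;
     0, 1 / (1 - ω ^ 2) + 3 * ω ^ 2 / (1 - ω ^ 2) ^ 2, 0, 0, 0, -(ω / (1 - ω ^ 2));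
     -(ε * ω / (2 * (1 - ω ^ 2))), 0, ε ^ 2 / 8, 0, 0, 0;
     0, 0, 0, 1 / 4, 0, 0;
     0, 0, 0, 0, 1 / 4, 0;
     0, -(ω / (1 - ω ^ 2)), 0, 0, 0, 1 / 2]

lemma criticalPoint_mem_regularSet {ω ε : ℝ} (hω : 1 - ω ^ 2 ≠ 0) (hε : ε ≠ 0) :
    criticalPoint ω ε ∈ regularSet ω := by
  have hs : 1 - ω * ω ≠ 0 := by rwa [← sq]
  simp [criticalPoint, regularSet, hε, hω, hs]

lemma reducedGradient_criticalPoint {ω ε : ℝ} (hω : 1 - ω ^ 2 ≠ 0) (j : Fin 6) :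
    reducedGradient ω ε (criticalPoint ω ε) j = 0 := by
  have hs : 1 - ω * ω ≠ 0 := by rwa [← sq]
  fin_cases j <;> simp [reducedGradient, criticalPoint] <;> field_simp <;> ring

lemma hasDerivAt_reducedGradient_update_criticalPoint {ω ε : ℝ} (hω : 1 - ω ^ 2 ≠ 0)
    (hε : ε ≠ 0) (i j : Fin 6) :
    HasDerivAt (fun t => reducedGradient ω ε (Function.update (criticalPoint ω ε) i t) j)
      ((2 * ε ^ 2 / (1 - ω ^ 2) ^ 2) * hessianMatrix ω ε i j) (criticalPoint ω ε i) := by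
  have hs : 1 - ω * ω ≠ 0 := by rwa [← sq]
  have hlam : 2 / ε ≠ 0 := div_ne_zero two_ne_zero hε
  have hD : 1 - ω ^ 2 - 0 ^ 2 ≠ 0 := by simpa
  have hQ : (1 - ω * ω) ^ 2 + ω ^ 2 * 0 ^ 2 ≠ 0 := by simpa
  fin_cases i <;> fin_cases j <;>
  · simp [reducedGradient, criticalPoint, hessianMatrix, Function.update]
    apply HasDerivAt.congr_deriv
    case h =>
      repeat' first
        | exact hasDerivAt_const _ _
        | exact hasDerivAt_id' _
        | with_reducible apply HasDerivAt.fun_add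
        | with_reducible apply HasDerivAt.fun_sub
        | with_reducible apply HasDerivAt.fun_neg
        | with_reducible apply HasDerivAt.fun_mul
        | with_reducible apply HasDerivAt.fun_div
        | with_reducible apply HasDerivAt.fun_inv
        | with_reducible apply HasDerivAt.fun_pow
        | apply HasDerivAt.cos
        | apply HasDerivAt.sin
        | exact hω
        | exact hs
        | exact hlam
        | exact hD
        | exact hQ
        | apply pow_ne_zero
        | apply mul_ne_zero
    case h' =>
      try simp
      try field_simp
      try ring

lemma posDef_hessianMatrix {ω ε : ℝ} (hω : 0 < 1 - ω ^ 2) (hε : ε ≠ 0) :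
    (hessianMatrix ω ε).PosDef := by
  refine Matrix.PosDef.of_dotProduct_mulVec_pos ?_ fun x hx => ?_
  · ext i j
    fin_cases i <;> fin_cases j <;> simp [hessianMatrix]
  · have hform : star x ⬝ᵥ (hessianMatrix ω ε).mulVec x =
        1 / (1 - ω ^ 2) * (x 0 ^ 2 + x 1 ^ 2) + (ω * x 0 / (1 - ω ^ 2)) ^ 2 +
        1 / 2 * (2 * ω * x 0 / (1 - ω ^ 2) - ε / 2 * x 2) ^ 2 +
        (ω * x 1 / (1 - ω ^ 2)) ^ 2 + 1 / 2 * (2 * ω * x 1 / (1 - ω ^ 2) - x 5) ^ 2 +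
        1 / 4 * (x 3 ^ 2 + x 4 ^ 2) := by
      simp [hessianMatrix, Matrix.mulVec, dotProduct, Fin.sum_univ_succ]
      field_simp
      ring
    rw [hform]
    by_contra hle
    have h01 : 0 ≤ 1 / (1 - ω ^ 2) * (x 0 ^ 2 + x 1 ^ 2) := by positivity
    have hsq0 := sq_nonneg (ω * x 0 / (1 - ω ^ 2))
    have hsq1 := sq_nonneg (ω * x 1 / (1 - ω ^ 2))
    have hsq2 := sq_nonneg (2 * ω * x 0 / (1 - ω ^ 2) - ε / 2 * x 2)
    have hsq5 := sq_nonneg (2 * ω * x 1 / (1 - ω ^ 2) - x 5)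
    have hsq3 := sq_nonneg (x 3)
    have hsq4 := sq_nonneg (x 4)
    have h01' : x 0 ^ 2 + x 1 ^ 2 = 0 := by
      have h : 1 / (1 - ω ^ 2) * (x 0 ^ 2 + x 1 ^ 2) = 0 := by linarith
      exact (mul_eq_zero.mp h).resolve_left (by positivity)
    have h0 : x 0 = 0 := by nlinarith [sq_nonneg (x 0), sq_nonneg (x 1)]
    have h1 : x 1 = 0 := by nlinarith [sq_nonneg (x 0), sq_nonneg (x 1)]
    have h3 : x 3 = 0 := pow_eq_zero_iff two_ne_zero |>.mp (by linarith)
    have h4 : x 4 = 0 := pow_eq_zero_iff two_ne_zero |>.mp (by linarith)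
    have h2 : x 2 = 0 := by
      have h : (2 * ω * x 0 / (1 - ω ^ 2) - ε / 2 * x 2) ^ 2 = 0 := by linarith
      simpa [h0, hε] using h
    have h5 : x 5 = 0 := by
      have h : (2 * ω * x 1 / (1 - ω ^ 2) - x 5) ^ 2 = 0 := by linarith
      simpa [h1] using h
    apply hx
    ext i
    fin_cases i <;> assumption

/-- Around a single concentration point, the reduced functional `F` has
`P₀ = (ω, 0, 2/ε, π/2, 0, 0)` as a critical point, with Hessian
`(2ε²/(1−ω²)²)·A_{ω,ε}` where `A_{ω,ε}` is the explicit positive definite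
matrix below. Variables are ordered `(x, y, λ, θ, ψ, φ) = (p 0, …, p 5)`. -/
theorem statement14
    (ω : ℝ) (hω : ω ∈ Set.Ioo (0 : ℝ) 1) (ε : ℝ) (hε : 0 < ε)
    (Q : ℝ × ℝ → ℝ)
    (hQ : ∀ p : ℝ × ℝ, Q p = (1 - ω * p.1) ^ 2 + ω ^ 2 * p.2 ^ 2)
    (d : (Fin 6 → ℝ) → ℝ)
    (hd : ∀ p : Fin 6 → ℝ, d p =
      (Real.cos (p 4) * Real.cos (p 5) - Real.cos (p 3) * Real.sin (p 5) * Real.sin (p 4) +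
          Real.sin (p 3) * Real.cos (p 5)) *
        (((1 - ω * p 0) ^ 2 - ω ^ 2 * (p 1) ^ 2) / (Q (p 0, p 1)) ^ 2) +
      2 * (Real.cos (p 4) * Real.sin (p 5) + Real.cos (p 3) * Real.cos (p 5) * Real.sin (p 4) +
          Real.sin (p 3) * Real.sin (p 5)) *
        (((1 - ω * p 0) * ω * p 1) / (Q (p 0, p 1)) ^ 2))
    (F : (Fin 6 → ℝ) → ℝ)
    (hF : ∀ p : Fin 6 → ℝ, F p =
      (1 / (p 2) ^ 2) * (2 / (1 - (p 0) ^ 2 - (p 1) ^ 2) ^ 2 - ε * p 2 * d p))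
    (P₀ : Fin 6 → ℝ) (hP₀ : P₀ = ![ω, 0, 2 / ε, Real.pi / 2, 0, 0])
    (A : Matrix (Fin 6) (Fin 6) ℝ)
    (hA : A = !![1 / (1 - ω ^ 2) + 3 * ω ^ 2 / (1 - ω ^ 2) ^ 2, 0,
                   -(ε * ω / (2 * (1 - ω ^ 2))), 0, 0, 0;
                 0, 1 / (1 - ω ^ 2) + 3 * ω ^ 2 / (1 - ω ^ 2) ^ 2, 0, 0, 0,
                   -(ω / (1 - ω ^ 2));
                 -(ε * ω / (2 * (1 - ω ^ 2))), 0, ε ^ 2 / 8, 0, 0, 0;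
                 0, 0, 0, 1 / 4, 0, 0;
                 0, 0, 0, 0, 1 / 4, 0;
                 0, -(ω / (1 - ω ^ 2)), 0, 0, 0, 1 / 2]) :
    fderiv ℝ F P₀ = 0 ∧
    (∀ i j : Fin 6,
      fderiv ℝ (fun p => fderiv ℝ F p (Pi.single j (1 : ℝ))) P₀ (Pi.single i (1 : ℝ)) =
        (2 * ε ^ 2 / (1 - ω ^ 2) ^ 2) * A i j) ∧
    A.PosDef := by
  have hs : 0 < 1 - ω ^ 2 := by nlinarith [hω.1, hω.2]
  have hFeq : F = reducedFunctional ω ε := by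
    funext p
    rw [hF, hd, hQ, reducedFunctional]
  obtain rfl : P₀ = criticalPoint ω ε := hP₀
  obtain rfl : A = hessianMatrix ω ε := hA
  subst hFeq
  have hmem := criticalPoint_mem_regularSet hs.ne' hε.ne'
  refine ⟨?_, fun i j => ?_, posDef_hessianMatrix hs hε.ne'⟩
  · apply ContinuousLinearMap.coe_injective
    refine (Pi.basisFun ℝ (Fin 6)).ext fun j => ?_
    simpa [reducedGradient_criticalPoint hs.ne'] using
      fderiv_reducedFunctional_single (ε := ε) hmem j
  · have heq : (fun p => fderiv ℝ (reducedFunctional ω ε) p (Pi.single j (1 : ℝ)))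
        =ᶠ[nhds (criticalPoint ω ε)] fun p => reducedGradient ω ε p j := by
      filter_upwards [(isOpen_regularSet ω).mem_nhds hmem] with p hp
      exact fderiv_reducedFunctional_single hp j
    have hdiff : DifferentiableAt ℝ
        (fun p => fderiv ℝ (reducedFunctional ω ε) p (Pi.single j (1 : ℝ)))
        (criticalPoint ω ε) :=
      (((contDiffAt_reducedFunctional hmem).fderiv_right (m := 1)
        (by norm_num)).differentiableAt (by norm_num)).clm_apply (differentiableAt_const _)
    rw [heq.fderiv_eq]
    exact fderiv_single_eq_of_hasDerivAt_update (heq.differentiableAt_iff.mp hdiff)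
      (hasDerivAt_reducedGradient_update_criticalPoint hs.ne' hε.ne' i j)
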